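/- arXiv:1512.07785 — 2 statements merged into one kernel-verified Lean document; each statement's English description precedes it below -/
import Mathlib

section
/- Let n ≥ 2 and let J_1 ≠ J_2 be subsets of {1,…,n} with ∅ ≠ J_m ≠ {1,…,n} for m = 1,2. Then there exists (η_1,η_2,θ) ∈ ℚ × ℚ × ℚ^n with η_1 < 0, η_2 < 0, η_1 + η_2 = −1, θ_i > 0 for all i, ∑_i θ_i = 1, and ∑_{i∈J_1} θ_i = −η_1 = ∑_{i∈J_2} θ_i, if and only if neither J_1 ⊆ J_2 nor J_2 ⊆ J_1. (Equivalently: two distinct inner walls W_{J_1}, W_{J_2} of Δ^1×Δ^{n−1} intersect in the interior of Δ^1×Δ^{n−1} if and only if J_1 and J_2 are incomparable.) -/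
open Finset

/-- A finite sum of positive terms strictly increases along strict inclusions. -/
theorem sum_lt_sum_of_ssubset_of_pos {ι : Type*} {s t : Finset ι} {w : ι → ℚ}
    (hst : s ⊂ t) (hw : ∀ i, 0 < w i) : ∑ i ∈ s, w i < ∑ i ∈ t, w i := by
  obtain ⟨i, hit, his⟩ := Finset.exists_of_ssubset hst
  exact Finset.sum_lt_sum_of_subset hst.subset hit his (hw i) fun j _ _ => (hw j).le

/-- Two incomparable finite sets have equal mass for some strictly positive weight. -/
theorem exists_pos_weight_sum_eq {ι : Type*} [DecidableEq ι] {s t : Finset ι}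
    (hst : ¬ s ⊆ t) (hts : ¬ t ⊆ s) :
    ∃ w : ι → ℚ, (∀ i, 0 < w i) ∧ ∑ i ∈ s, w i = ∑ i ∈ t, w i := by
  have ha : (0 : ℚ) < #(s \ t) := by
    exact_mod_cast Finset.card_pos.2 (Finset.sdiff_nonempty.2 hst)
  have hb : (0 : ℚ) < #(t \ s) := by
    exact_mod_cast Finset.card_pos.2 (Finset.sdiff_nonempty.2 hts)
  refine ⟨fun i => if i ∈ s \ t then (#(t \ s) : ℚ) else if i ∈ t \ s then #(s \ t) else 1,
    fun i => ?_, ?_⟩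
  · dsimp only
    split_ifs <;> first | assumption | exact one_pos
  · rw [← Finset.sum_sdiff_eq_sum_sdiff_iff]
    have hs : ∀ i ∈ s \ t, (if i ∈ s \ t then (#(t \ s) : ℚ)
        else if i ∈ t \ s then #(s \ t) else 1) = #(t \ s) := fun i hi => if_pos hi
    have ht : ∀ i ∈ t \ s, (if i ∈ s \ t then (#(t \ s) : ℚ)
        else if i ∈ t \ s then #(s \ t) else 1) = #(s \ t) := fun i hi => by
      rw [if_neg fun h => (Finset.mem_sdiff.1 h).2 (Finset.mem_sdiff.1 hi).1, if_pos hi]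
    rw [Finset.sum_congr rfl hs, Finset.sum_congr rfl ht]
    simp only [Finset.sum_const, nsmul_eq_mul]
    ring

/-- Two distinct inner walls `W_{J₁}`, `W_{J₂}` of `Δ¹×Δ^{n−1}` intersect in the interior
of `Δ¹×Δ^{n−1}` if and only if `J₁` and `J₂` are incomparable. -/
theorem pn_inner_walls_intersect_interior_iff {n : ℕ} (hn : 2 ≤ n)
    (J1 J2 : Finset (Fin n)) (hne : J1 ≠ J2)
    (h1 : J1 ≠ ∅) (h1' : J1 ≠ Finset.univ) (h2 : J2 ≠ ∅) (h2' : J2 ≠ Finset.univ) :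
    (∃ (η1 η2 : ℚ) (θ : Fin n → ℚ), η1 < 0 ∧ η2 < 0 ∧ η1 + η2 = -1 ∧
      (∀ i, 0 < θ i) ∧ ∑ i, θ i = 1 ∧
      ∑ i ∈ J1, θ i = -η1 ∧ ∑ i ∈ J2, θ i = -η1) ↔
    (¬ J1 ⊆ J2 ∧ ¬ J2 ⊆ J1) := by
  constructor
  · rintro ⟨η1, η2, θ, -, -, -, hθ, -, e1, e2⟩
    refine ⟨fun h => ?_, fun h => ?_⟩
    · exact (sum_lt_sum_of_ssubset_of_pos (h.ssubset_of_ne hne) hθ).ne (e1.trans e2.symm)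
    · exact (sum_lt_sum_of_ssubset_of_pos (h.ssubset_of_ne hne.symm) hθ).ne (e2.trans e1.symm)
  · rintro ⟨h12, h21⟩
    obtain ⟨w, hw, he⟩ := exists_pos_weight_sum_eq h12 h21
    have hpos : 0 < ∑ i ∈ J1, w i :=
      Finset.sum_pos (fun i _ => hw i) (Finset.nonempty_iff_ne_empty.2 h1)
    have hlt : ∑ i ∈ J1, w i < ∑ i, w i :=
      sum_lt_sum_of_ssubset_of_pos (Finset.ssubset_univ_iff.2 h1') hw
    have hS : 0 < ∑ i, w i := hpos.trans hlt
    have hq : 0 < (∑ i ∈ J1, w i) / ∑ i, w i := div_pos hpos hS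
    have hq' : (∑ i ∈ J1, w i) / ∑ i, w i < 1 := (div_lt_one hS).2 hlt
    refine ⟨-((∑ i ∈ J1, w i) / ∑ i, w i), (∑ i ∈ J1, w i) / (∑ i, w i) - 1,
      fun i => w i / ∑ j, w j, by linarith, by linarith, by ring,
      fun i => div_pos (hw i) hS, ?_, ?_, ?_⟩
    · rw [← Finset.sum_div, div_self hS.ne']
    · rw [← Finset.sum_div, neg_neg]
    · rw [← Finset.sum_div, neg_neg, he]
end

section
/- Let k be a field, n ≥ 1, and a ≠ b in {1,…,n+2}. Let θ, θ' ∈ Δ(2,n+2) satisfy 0 < ∑_{i≠a,b} θ_i ≤ θ_a + θ_b and 0 < ∑_{i≠a,b} θ'_i ≤ θ'_a + θ'_b, and suppose θ and θ' have the same image under the projection θ ↦ (λ(θ_a−1)+1, λ(θ_b−1)+1, (λθ_i)_{i≠a,b}) with λ = 1/∑_{i≠a,b} θ_i, i.e. λ(θ_a−1) = λ'(θ'_a−1), λ(θ_b−1) = λ'(θ'_b−1) and λθ_i = λ'θ'_i for all i ≠ a,b, where λ' = 1/∑_{i≠a,b} θ'_i. Then for every tuple s = (s_1,…,s_{n+2})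 of vectors in k^2 such that s_a and s_b are linearly independent: s is θ-semistable if and only if s is θ'-semistable. If moreover ∑_{i≠a,b} θ_i < θ_a + θ_b and ∑_{i≠a,b} θ'_i < θ'_a + θ'_b, then also: s is θ-stable if and only if s is θ'-stable. -/
noncomputable section

open Finset
open scoped Classical

variable {k : Type*} [Field k]

/-- A pair `(U, W)` is a subrepresentation of the representation `s` of the quiver `Q_n`
(with dimension vector `(2;1,…,1)`) if `s i ∈ W` for all `i ∈ U`. -/
def QnIsSubrep {n : ℕ} (s : Fin n → Fin 2 → k) (U : Finset (Fin n))
    (W : Submodule k (Fin 2 → k)) : Prop :=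
  ∀ i ∈ U, s i ∈ W

/-- `s` is `θ`-semistable: `θ(U,W) = -dim W + ∑_{i∈U} θ_i ≤ 0` for every subrepresentation. -/
def QnSemistable {n : ℕ} (θ : Fin n → ℚ) (s : Fin n → Fin 2 → k) : Prop :=
  ∀ (U : Finset (Fin n)) (W : Submodule k (Fin 2 → k)), QnIsSubrep s U W →
    -(Module.finrank k W : ℚ) + ∑ i ∈ U, θ i ≤ 0

/-- `s` is `θ`-stable: semistable, and `θ(U,W) < 0` for every subrepresentation other than
`(∅, 0)` and `({1,…,n}, k²)`. -/
def QnStable {n : ℕ} (θ : Fin n → ℚ) (s : Fin n → Fin 2 → k) : Prop :=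
  QnSemistable θ s ∧
  ∀ (U : Finset (Fin n)) (W : Submodule k (Fin 2 → k)), QnIsSubrep s U W →
    ¬(U = ∅ ∧ W = ⊥) → ¬(U = Finset.univ ∧ W = ⊤) →
    -(Module.finrank k W : ℚ) + ∑ i ∈ U, θ i < 0

/-- If the vectors `s i`, `i ∈ P`, are linearly independent, then a subrepresentation `(U, W)`
has at most `dim W` indices in `P`. -/
theorem QnIsSubrep.card_inter_le_finrank {m : ℕ} {s : Fin m → Fin 2 → k} {P U : Finset (Fin m)}
    {W : Submodule k (Fin 2 → k)} (hs : LinearIndepOn k s (P : Set (Fin m)))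
    (h : QnIsSubrep s U W) : #(U ∩ P) ≤ Module.finrank k W := by
  have hli : LinearIndependent k (fun i : ↥(U ∩ P) => s i) :=
    hs.mono (coe_subset.2 inter_subset_right)
  have hW : LinearIndependent k
      (fun i : ↥(U ∩ P) => (⟨s i, h i (mem_inter.1 i.2).1⟩ : W)) :=
    LinearIndependent.of_comp W.subtype hli
  simpa only [Fintype.card_coe] using hW.fintype_card_le_finrank

/-- The value `θ(U, W)`, split along an index set `P`. -/
theorem qn_weight_eq {m : ℕ} (θ : Fin m → ℚ) (P U : Finset (Fin m)) (d : ℕ) :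
    -(d : ℚ) + ∑ i ∈ U, θ i =
      (∑ i ∈ U ∩ P, (θ i - 1) + ∑ i ∈ U \ P, θ i) + ((#(U ∩ P) : ℚ) - d) := by
  rw [← sum_inter_add_sum_sdiff U P θ, sum_sub_distrib, sum_const, nsmul_one]
  ring

/-- Suppose `θ' - 1 = t (θ - 1)` on `P` and `θ' = t θ` off `P`. If `(U, W)` has `dim W` indices
in `P`, then `θ'(U, W) = t θ(U, W)`. -/
theorem qn_weight_smul {m : ℕ} {θ θ' : Fin m → ℚ} {P U : Finset (Fin m)} {t : ℚ} {d : ℕ}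
    (hP : ∀ i ∈ P, θ' i - 1 = t * (θ i - 1)) (hPc : ∀ i ∈ Pᶜ, θ' i = t * θ i)
    (hd : #(U ∩ P) = d) :
    -(d : ℚ) + ∑ i ∈ U, θ' i = t * (-(d : ℚ) + ∑ i ∈ U, θ i) := by
  rw [qn_weight_eq θ' P, qn_weight_eq θ P, hd,
    sum_congr rfl fun i hi => hP i (mem_inter.1 hi).2,
    sum_congr rfl fun i hi => hPc i (mem_compl.2 (mem_sdiff.1 hi).2), ← mul_sum, ← mul_sum]
  ring

/-- If `(U, W)` has fewer than `dim W` indices in `P`, then `θ(U, W)` is at most the total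
weight off `P`, minus one. -/
theorem qn_weight_le {m : ℕ} {θ : Fin m → ℚ} {P U : Finset (Fin m)} {d : ℕ}
    (h0 : ∀ i, 0 ≤ θ i) (h1 : ∀ i, θ i ≤ 1) (hd : #(U ∩ P) < d) :
    -(d : ℚ) + ∑ i ∈ U, θ i ≤ ∑ i ∈ Pᶜ, θ i - 1 := by
  rw [qn_weight_eq θ P]
  have h2 : ∑ i ∈ U ∩ P, (θ i - 1) ≤ 0 := sum_nonpos fun i _ => sub_nonpos.2 (h1 i)
  have h3 : ∑ i ∈ U \ P, θ i ≤ ∑ i ∈ Pᶜ, θ i :=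
    sum_le_sum_of_subset_of_nonneg (fun i hi => mem_compl.2 (mem_sdiff.1 hi).2) fun i _ _ => h0 i
  have h4 : (#(U ∩ P) : ℚ) + 1 ≤ d := by exact_mod_cast hd
  linarith

/-- Semistability passes from `θ` to `θ'` when `θ' - 1 = t (θ - 1)` on `P` and `θ' = t θ`
off `P`. -/
theorem QnSemistable.of_smul {m : ℕ} {θ θ' : Fin m → ℚ} {P : Finset (Fin m)} {t : ℚ}
    {s : Fin m → Fin 2 → k} (hθ : QnSemistable θ s) (ht : 0 ≤ t)
    (hs : LinearIndepOn k s (P : Set (Fin m)))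
    (h0 : ∀ i, 0 ≤ θ' i) (h1 : ∀ i, θ' i ≤ 1)
    (hP : ∀ i ∈ P, θ' i - 1 = t * (θ i - 1)) (hPc : ∀ i ∈ Pᶜ, θ' i = t * θ i)
    (hsum : ∑ i ∈ Pᶜ, θ' i ≤ 1) : QnSemistable θ' s := by
  intro U W h
  rcases (h.card_inter_le_finrank hs).eq_or_lt with hd | hd
  · rw [qn_weight_smul hP hPc hd]
    exact mul_nonpos_of_nonneg_of_nonpos ht (hθ U W h)
  · linarith [qn_weight_le h0 h1 hd]

/-- Stability passes from `θ` to `θ'` when `θ' - 1 = t (θ - 1)` on `P` and `θ' = t θ`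
off `P`. -/
theorem QnStable.of_smul {m : ℕ} {θ θ' : Fin m → ℚ} {P : Finset (Fin m)} {t : ℚ}
    {s : Fin m → Fin 2 → k} (hθ : QnStable θ s) (ht : 0 < t)
    (hs : LinearIndepOn k s (P : Set (Fin m)))
    (h0 : ∀ i, 0 ≤ θ' i) (h1 : ∀ i, θ' i ≤ 1)
    (hP : ∀ i ∈ P, θ' i - 1 = t * (θ i - 1)) (hPc : ∀ i ∈ Pᶜ, θ' i = t * θ i)
    (hsum : ∑ i ∈ Pᶜ, θ' i < 1) : QnStable θ' s := by
  refine ⟨hθ.1.of_smul ht.le hs h0 h1 hP hPc hsum.le, fun U W h hbot htop => ?_⟩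
  rcases (h.card_inter_le_finrank hs).eq_or_lt with hd | hd
  · rw [qn_weight_smul hP hPc hd]
    exact mul_neg_of_pos_of_neg ht (hθ.2 U W h hbot htop)
  · linarith [qn_weight_le h0 h1 hd]

/-- Weights in the cone over the vertex `e_a + e_b` of `Δ(2,n+2)` with the same image under
the projection to the wall `W_{{a,b},{a,b}^∁}` have the same (semi)stable representations
among those with `s_a, s_b` linearly independent. -/
theorem qn_projection_same_stability {n : ℕ} (hn : 1 ≤ n)
    (a b : Fin (n + 2)) (hab : a ≠ b)
    (θ θ' : Fin (n + 2) → ℚ)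
    (hΔ : (∀ i, 0 ≤ θ i ∧ θ i ≤ 1) ∧ ∑ i, θ i = 2)
    (hΔ' : (∀ i, 0 ≤ θ' i ∧ θ' i ≤ 1) ∧ ∑ i, θ' i = 2)
    (hpos : 0 < ∑ i ∈ ({a, b} : Finset (Fin (n + 2)))ᶜ, θ i)
    (hle : ∑ i ∈ ({a, b} : Finset (Fin (n + 2)))ᶜ, θ i ≤ θ a + θ b)
    (hpos' : 0 < ∑ i ∈ ({a, b} : Finset (Fin (n + 2)))ᶜ, θ' i)
    (hle' : ∑ i ∈ ({a, b} : Finset (Fin (n + 2)))ᶜ, θ' i ≤ θ' a + θ' b)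
    (lam lam' : ℚ)
    (hlam : lam = 1 / ∑ i ∈ ({a, b} : Finset (Fin (n + 2)))ᶜ, θ i)
    (hlam' : lam' = 1 / ∑ i ∈ ({a, b} : Finset (Fin (n + 2)))ᶜ, θ' i)
    (hima : lam * (θ a - 1) = lam' * (θ' a - 1))
    (himb : lam * (θ b - 1) = lam' * (θ' b - 1))
    (him : ∀ i ∈ ({a, b} : Finset (Fin (n + 2)))ᶜ, lam * θ i = lam' * θ' i) :
    ∀ s : Fin (n + 2) → Fin 2 → k, LinearIndependent k ![s a, s b] →
      (QnSemistable θ s ↔ QnSemistable θ' s) ∧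
      ((∑ i ∈ ({a, b} : Finset (Fin (n + 2)))ᶜ, θ i < θ a + θ b) →
        (∑ i ∈ ({a, b} : Finset (Fin (n + 2)))ᶜ, θ' i < θ' a + θ' b) →
        (QnStable θ s ↔ QnStable θ' s)) := by
  intro s hs
  have hlam_pos : 0 < lam := hlam ▸ one_div_pos.2 hpos
  have hlam_pos' : 0 < lam' := hlam' ▸ one_div_pos.2 hpos'
  have hsP : LinearIndepOn k s (({a, b} : Finset (Fin (n + 2))) : Set (Fin (n + 2))) := by
    rw [coe_pair, LinearIndepOn.pair_iff s hab]
    exact LinearIndependent.pair_iff.1 hs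
  have himP : ∀ i ∈ ({a, b} : Finset (Fin (n + 2))), lam * (θ i - 1) = lam' * (θ' i - 1) := by
    simp [hima, himb]
  have hsum : ∑ i ∈ ({a, b} : Finset (Fin (n + 2)))ᶜ, θ i + (θ a + θ b) = 2 := by
    rw [← sum_pair hab, sum_compl_add_sum, hΔ.2]
  have hsum' : ∑ i ∈ ({a, b} : Finset (Fin (n + 2)))ᶜ, θ' i + (θ' a + θ' b) = 2 := by
    rw [← sum_pair hab, sum_compl_add_sum, hΔ'.2]
  have ht : 0 < lam / lam' := div_pos hlam_pos hlam_pos'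
  have ht' : 0 < lam' / lam := div_pos hlam_pos' hlam_pos
  have solve : ∀ {u v x y : ℚ}, 0 < v → u * x = v * y → y = u / v * x := by
    intro u v x y hv h
    rw [div_mul_eq_mul_div, h, mul_div_cancel_left₀ _ hv.ne']
  have hP := fun i hi => solve hlam_pos' (himP i hi)
  have hPc := fun i hi => solve hlam_pos' (him i hi)
  have hP' := fun i hi => solve hlam_pos (himP i hi).symm
  have hPc' := fun i hi => solve hlam_pos (him i hi).symm
  have h0 := fun i => (hΔ.1 i).1
  have h1 := fun i => (hΔ.1 i).2
  have h0' := fun i => (hΔ'.1 i).1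
  have h1' := fun i => (hΔ'.1 i).2
  refine ⟨⟨fun h => h.of_smul ht.le hsP h0' h1' hP hPc (by linarith),
    fun h => h.of_smul ht'.le hsP h0 h1 hP' hPc' (by linarith)⟩, fun hlt hlt' =>
    ⟨fun h => h.of_smul ht hsP h0' h1' hP hPc (by linarith),
    fun h => h.of_smul ht' hsP h0 h1 hP' hPc' (by linarith)⟩⟩
end
end
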